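/- Assume q ≠ 0, so that each T_j is invertible with T_j^{-1} = q^{-1}·(T_j + (1-q)·1). Let δ = 1 if n is odd and δ = -1 if n is even, let d = 1 if n is odd and d = 0 if n is even, and let r = (n-d)/2. Then for every integer m ≥ 1 there exists a family of scalars f_l ∈ K indexed by l ∈ ℒ_n such that (T_1 · T_2^{-1} · T_3 · T_4^{-1} ⋯ T_n^{δ})^m = q^{-mr} · Σ_{l ∈ ℒ_n} f_l · β_n^l; in particular, the m-th power of the weaving element T_1 T_2^{-1} T_3 T_4^{-1} ⋯ T_n^{δ} lies in the K-linear span of the set ℬ_n. -/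

import Mathlib

/-- `uElt T i j` is the element `u_i^j`: the product `T_i T_{i-1} ⋯ T_{i-j+1}`
(interpreted as `1` when `j = 0`). -/
def uElt {A : Type*} [Monoid A] (T : ℕ → A) (i j : ℕ) : A :=
  ((List.range j).map fun t => T (i - t)).prod

/-- `betaElt T n l` is the element `β_n^l = u_1^{l_1} u_2^{l_2} ⋯ u_n^{l_n}`, where the
tuple `(l_1, …, l_n)` is encoded as `l : Fin n → ℕ` (so `l i` is `l_{i+1}`). -/
def betaElt {A : Type*} [Monoid A] (T : ℕ → A) (n : ℕ) (l : Fin n → ℕ) : A :=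
  (List.ofFn fun i : Fin n => uElt T (i.1 + 1) (l i)).prod

/-- The set `ℬ_n = {β_n^l : l ∈ ℒ_n}`, where `ℒ_n` is the set of tuples `(l_1, …, l_n)`
with `0 ≤ l_j ≤ j` for each `j`. -/
def heckeBasisSet {A : Type*} [Monoid A] (T : ℕ → A) (n : ℕ) : Set A :=
  {a : A | ∃ l : Fin n → ℕ, (∀ i : Fin n, l i ≤ i.1 + 1) ∧ a = betaElt T n l}

theorem uElt_succ {A : Type*} [Monoid A] (T : ℕ → A) (i j : ℕ) :
    uElt T i (j + 1) = uElt T i j * T (i - j) := by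
  simp [uElt, List.range_succ]

theorem uElt_comm_low {A : Type*} [Monoid A] (n : ℕ) (T : ℕ → A)
    (hc : ∀ j k, 1 ≤ k → k + 2 ≤ j → j ≤ n → T j * T k = T k * T j)
    (i : ℕ) (hi : i ≤ n) (j k : ℕ) (hk : 1 ≤ k) (hkj : k + j < i) :
    uElt T i j * T k = T k * uElt T i j := by
  induction j with
  | zero => simp [uElt]
  | succ j ih =>
    rw [uElt_succ, mul_assoc, hc (i - j) k hk (by omega) (by omega), ← mul_assoc,
      ih (by omega), mul_assoc]

theorem uElt_shift {A : Type*} [Monoid A] (n : ℕ) (T : ℕ → A)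
    (hc : ∀ j k, 1 ≤ k → k + 2 ≤ j → j ≤ n → T j * T k = T k * T j)
    (hb : ∀ j, 1 ≤ j → j + 1 ≤ n →
      T j * T (j + 1) * T j = T (j + 1) * T j * T (j + 1))
    (i : ℕ) (hi : i ≤ n) (j k : ℕ) (hj : j ≤ i) (hk : i + 1 < k + j) (hki : k ≤ i) :
    uElt T i j * T k = T (k - 1) * uElt T i j := by
  induction j with
  | zero => omega
  | succ j ih =>
    by_cases h : i + 1 < k + j
    · rw [uElt_succ, mul_assoc, ← hc k (i - j) (by omega) (by omega) (by omega), ← mul_assoc,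
        ih (by omega) h, mul_assoc]
    · obtain ⟨p, rfl⟩ : ∃ p, k = p + 1 := ⟨k - 1, by omega⟩
      obtain ⟨t, rfl⟩ : ∃ t, j = t + 1 := ⟨j - 1, by omega⟩
      have e1 : i - (t + 1) = p := by omega
      have e2 : i - t = p + 1 := by omega
      have hA := uElt_comm_low n T hc i hi t p (by omega) (by omega)
      have hB := hb p (by omega) (by omega)
      rw [uElt_succ, uElt_succ, e1, e2, Nat.add_sub_cancel]
      calc uElt T i t * T (p + 1) * T p * T (p + 1)
          = uElt T i t * (T (p + 1) * T p * T (p + 1)) := by simp only [mul_assoc]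
        _ = (uElt T i t * T p) * T (p + 1) * T p := by rw [← hB]; simp only [mul_assoc]
        _ = _ := by rw [hA]; simp only [mul_assoc]

theorem betaElt_succ {A : Type*} [Monoid A] (T : ℕ → A) (n : ℕ) (l : Fin (n + 1) → ℕ) :
    betaElt T (n + 1) l
      = betaElt T n (fun i => l i.castSucc) * uElt T (n + 1) (l (Fin.last n)) := by
  rw [betaElt, List.ofFn_succ', List.concat_eq_append, List.prod_append, List.prod_singleton]
  rfl

theorem span_mul_uElt {K : Type*} [Field K] {A : Type*} [Ring A] [Algebra K A] (T : ℕ → A)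
    (i j : ℕ) (hj : j ≤ i + 1) (a : A) (ha : a ∈ Submodule.span K (heckeBasisSet T i)) :
    a * uElt T (i + 1) j ∈ Submodule.span K (heckeBasisSet T (i + 1)) := by
  induction ha using Submodule.span_induction with
  | mem x hx =>
    obtain ⟨l, hl, rfl⟩ := hx
    refine Submodule.subset_span ⟨Fin.snoc (α := fun _ => ℕ) l j, ?_, ?_⟩
    · intro t
      refine Fin.lastCases ?_ (fun t => ?_) t
      · simpa using hj
      · simpa using hl t
    · rw [betaElt_succ]; simp
  | zero => simp
  | add x y _ _ hx hy => rw [add_mul]; exact Submodule.add_mem _ hx hy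
  | smul c x _ hx => rw [smul_mul_assoc]; exact Submodule.smul_mem _ _ hx

theorem span_mul_T {K : Type*} [Field K] (q : K) {A : Type*} [Ring A] [Algebra K A]
    (n : ℕ) (T : ℕ → A)
    (hc : ∀ j k, 1 ≤ k → k + 2 ≤ j → j ≤ n → T j * T k = T k * T j)
    (hb : ∀ j, 1 ≤ j → j + 1 ≤ n →
      T j * T (j + 1) * T j = T (j + 1) * T j * T (j + 1))
    (hquad : ∀ j, 1 ≤ j → j ≤ n → T j ^ 2 = (q - 1) • T j + q • (1 : A))
    (i : ℕ) (hi : i ≤ n) : ∀ k, 1 ≤ k → k ≤ i → ∀ a ∈ Submodule.span K (heckeBasisSet T i),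
      a * T k ∈ Submodule.span K (heckeBasisSet T i) := by
  induction i with
  | zero => intro k h1 h2; omega
  | succ i ih =>
    intro k hk1 hki a ha
    induction ha using Submodule.span_induction with
    | zero => simp
    | add x y _ _ hx hy => rw [add_mul]; exact Submodule.add_mem _ hx hy
    | smul c x _ hx => rw [smul_mul_assoc]; exact Submodule.smul_mem _ _ hx
    | mem x hx =>
      obtain ⟨l, hl, rfl⟩ := hx
      rw [betaElt_succ]
      have hs : betaElt T i (fun t => l t.castSucc) ∈ Submodule.span K (heckeBasisSet T i) :=
        Submodule.subset_span ⟨_, fun t => by simpa using hl t.castSucc, rfl⟩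
      have hj : l (Fin.last i) ≤ i + 1 := by simpa using hl (Fin.last i)
      generalize betaElt T i (fun t => l t.castSucc) = s at hs
      generalize l (Fin.last i) = j at hj
      rw [mul_assoc]
      rcases lt_trichotomy (k + j) (i + 1) with h | h | h
      · rw [uElt_comm_low n T hc (i + 1) hi j k hk1 h, ← mul_assoc]
        exact span_mul_uElt T i j hj _ (ih (by omega) k hk1 (by omega) s hs)
      · have e : k = i + 1 - j := by omega
        rw [e, ← uElt_succ]
        exact span_mul_uElt T i _ (by omega) _ hs
      · by_cases hlast : k + j = i + 2
        · obtain ⟨t, rfl⟩ : ∃ t, j = t + 1 := ⟨j - 1, by omega⟩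
          have e : i + 1 - t = k := by omega
          have e2 : uElt T (i + 1) (t + 1) * T k
              = (q - 1) • uElt T (i + 1) (t + 1) + q • uElt T (i + 1) t := by
            rw [uElt_succ, e, mul_assoc, ← pow_two, hquad k hk1 (by omega), mul_add,
              mul_smul_comm, mul_smul_comm, mul_one]
          rw [e2, mul_add, mul_smul_comm, mul_smul_comm]
          exact Submodule.add_mem _
            (Submodule.smul_mem _ _ (span_mul_uElt T i _ hj _ hs))
            (Submodule.smul_mem _ _ (span_mul_uElt T i _ (by omega) _ hs))
        · rw [uElt_shift n T hc hb (i + 1) hi j k hj (by omega) hki, ← mul_assoc]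
          exact span_mul_uElt T i j hj _ (ih (by omega) (k - 1) (by omega) (by omega) s hs)

theorem one_mem_span_hecke {K : Type*} [Field K] {A : Type*} [Ring A] [Algebra K A]
    (T : ℕ → A) (n : ℕ) : (1 : A) ∈ Submodule.span K (heckeBasisSet T n) := by
  refine Submodule.subset_span ⟨fun _ => 0, fun _ => Nat.zero_le _, ?_⟩
  symm
  apply List.prod_eq_one
  intro x hx
  rw [List.mem_ofFn] at hx
  obtain ⟨t, rfl⟩ := hx
  simp [uElt]

theorem span_mul_list {K : Type*} [Field K] {A : Type*} [Ring A] [Algebra K A]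
    (S : Submodule K A) (L : List A) (hL : ∀ x ∈ L, ∀ a ∈ S, a * x ∈ S) :
    ∀ a ∈ S, a * L.prod ∈ S := by
  induction L with
  | nil => simp
  | cons x L ih =>
    intro a ha
    rw [List.prod_cons, ← mul_assoc]
    exact ih (fun y hy => hL y (List.mem_cons_of_mem _ hy)) _ (hL x List.mem_cons_self a ha)

theorem weaving_element_pow_expansion {K : Type*} [Field K] (q : K) (hq : q ≠ 0)
    {A : Type*} [Ring A] [Algebra K A] (n : ℕ) (T : ℕ → A)
    (hcomm : ∀ j k, 1 ≤ j → j ≤ n → 1 ≤ k → k ≤ n → 2 ≤ |(j : ℤ) - (k : ℤ)| →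
      T j * T k = T k * T j)
    (hbraid : ∀ j, 1 ≤ j → j + 1 ≤ n →
      T j * T (j + 1) * T j = T (j + 1) * T j * T (j + 1))
    (hquad : ∀ j, 1 ≤ j → j ≤ n → T j ^ 2 = (q - 1) • T j + q • (1 : A))
    (m : ℕ) (hm : 1 ≤ m) :
    (∃ f : (Fin n → ℕ) → K,
      (((List.range n).map fun j =>
          if Odd (j + 1) then T (j + 1)
          else q⁻¹ • (T (j + 1) + (1 - q) • (1 : A))).prod) ^ m =
        (q ^ (-((m * ((n - (if Odd n then 1 else 0)) / 2) : ℕ) : ℤ))) •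
          ∑ l ∈ Fintype.piFinset fun i : Fin n => Finset.range (i.1 + 2),
            f l • betaElt T n l) ∧
    (((List.range n).map fun j =>
        if Odd (j + 1) then T (j + 1)
        else q⁻¹ • (T (j + 1) + (1 - q) • (1 : A))).prod) ^ m ∈
      Submodule.span K (heckeBasisSet T n) := by
  have hc : ∀ j k, 1 ≤ k → k + 2 ≤ j → j ≤ n → T j * T k = T k * T j := by
    intro j k h1 h2 h3
    refine hcomm j k (by omega) h3 h1 (by omega) ?_
    rw [abs_of_nonneg (by omega)]
    omega
  have hT := span_mul_T q n T hc hbraid hquad n le_rfl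
  generalize hW : (((List.range n).map fun j =>
        if Odd (j + 1) then T (j + 1)
        else q⁻¹ • (T (j + 1) + (1 - q) • (1 : A))).prod) = W
  have hWmul : ∀ a ∈ Submodule.span K (heckeBasisSet T n),
      a * W ∈ Submodule.span K (heckeBasisSet T n) := by
    rw [← hW]
    apply span_mul_list
    intro x hx a ha
    rw [List.mem_map] at hx
    obtain ⟨j, hj, rfl⟩ := hx
    rw [List.mem_range] at hj
    have h1 := hT (j + 1) (by omega) (by omega) a ha
    split_ifs
    · exact h1
    · rw [mul_smul_comm, mul_add, mul_smul_comm, mul_one]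
      exact Submodule.smul_mem _ _ (Submodule.add_mem _ h1 (Submodule.smul_mem _ _ ha))
  have hmem : W ^ m ∈ Submodule.span K (heckeBasisSet T n) := by
    clear hm
    induction m with
    | zero => simpa using one_mem_span_hecke T n
    | succ m ih => rw [pow_succ]; exact hWmul _ ih
  refine ⟨?_, hmem⟩
  generalize (-((m * ((n - (if Odd n then 1 else 0)) / 2) : ℕ) : ℤ)) = z
  have hset : heckeBasisSet T n = Set.image (betaElt T n)
      (Fintype.piFinset fun i : Fin n => Finset.range (i.1 + 2) : Finset (Fin n → ℕ)) := by
    ext a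
    simp only [heckeBasisSet, Set.mem_ofPred_eq, Set.mem_image, Finset.mem_coe,
      Fintype.mem_piFinset, Finset.mem_range]
    constructor
    · rintro ⟨l, hl, rfl⟩
      exact ⟨l, fun i => by have := hl i; omega, rfl⟩
    · rintro ⟨l, hl, rfl⟩
      exact ⟨l, fun i => by have := hl i; omega, rfl⟩
  have h2 := Submodule.smul_mem _ (q ^ z)⁻¹ hmem
  rw [hset, Submodule.mem_span_image_finset_iff_exists_fun'] at h2
  obtain ⟨f, hf⟩ := h2
  refine ⟨f, ?_⟩
  rw [hf, smul_smul, mul_inv_cancel₀ (zpow_ne_zero _ hq), one_smul]
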